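/- arXiv:1904.09070 — 2 statements merged into one kernel-verified Lean document; each statement's English description precedes it below -/
import Mathlib

section
/- For every real number n > 0, the identity Φ₂(n) = √(2/n)·Ψ₂(1/n) + Ψ₂(n) holds, where Φ₂(a) = ∫₀^∞ cos(π a x²)/(1 + 2·cosh(2π x/√3)) dx and Ψ₂(a) = ∫₀^∞ sin(π a x²)/(1 + 2·cosh(2π x/√3)) dx. -/
open Real MeasureTheory

noncomputable def Phi2 (a : ℝ) : ℝ :=
  ∫ x in Set.Ioi (0:ℝ), Real.cos (π * a * x ^ 2) / (1 + 2 * Real.cosh (2 * π * x / Real.sqrt 3))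

noncomputable def Psi2 (a : ℝ) : ℝ :=
  ∫ x in Set.Ioi (0:ℝ), Real.sin (π * a * x ^ 2) / (1 + 2 * Real.cosh (2 * π * x / Real.sqrt 3))

noncomputable def ff (x : ℝ) : ℝ := 1 / (1 + 2 * Real.cosh (2 * π * x / Real.sqrt 3))

lemma ff_den_pos (x : ℝ) : 0 < 1 + 2 * Real.cosh (2 * π * x / Real.sqrt 3) := by
  have := Real.cosh_pos (2 * π * x / Real.sqrt 3); linarith

lemma ff_cont : Continuous ff := by
  unfold ff
  refine Continuous.div (by fun_prop) (by fun_prop) (fun x => (ff_den_pos x).ne')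

lemma ff_neg (x : ℝ) : ff (-x) = ff x := by
  unfold ff
  rw [show 2 * π * -x / Real.sqrt 3 = -(2 * π * x / Real.sqrt 3) by ring, Real.cosh_neg]

lemma ff_nonneg (x : ℝ) : 0 ≤ ff x := by
  unfold ff; have := ff_den_pos x; positivity

lemma cpos : 0 < 2 * π / Real.sqrt 3 := by positivity

lemma ff_le (x : ℝ) : ff x ≤ Real.exp (-(2 * π / Real.sqrt 3) * x) := by
  unfold ff
  rw [div_le_iff₀ (ff_den_pos x), Real.cosh_eq]
  rw [show 2 * π * x / Real.sqrt 3 = (2 * π / Real.sqrt 3) * x by ring]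
  rw [show -(2 * π / Real.sqrt 3) * x = -((2 * π / Real.sqrt 3) * x) by ring]
  set u := (2 * π / Real.sqrt 3) * x
  have h1 : Real.exp (-u) * Real.exp u = 1 := by rw [← Real.exp_add]; simp
  have := Real.exp_pos (-u)
  nlinarith [sq_nonneg (Real.exp (-u))]

lemma ff_intOn : IntegrableOn ff (Set.Ioi 0) := by
  refine Integrable.mono' (integrableOn_exp_mul_Ioi (a := -(2 * π / Real.sqrt 3))
    (by have := cpos; linarith) 0) ff_cont.aestronglyMeasurable ?_
  filter_upwards with x
  rw [Real.norm_of_nonneg (ff_nonneg x)]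
  exact ff_le x

lemma ff_intOn' : IntegrableOn ff (Set.Iic 0) := by
  rw [integrableOn_Iic_iff_integrableOn_Iio]
  have h := ff_intOn.comp_neg
  simpa only [ff_neg, Set.neg_Ioi, neg_zero] using h

lemma ff_int : Integrable ff := by
  rw [← integrableOn_univ, ← Set.Iic_union_Ioi (a := (0:ℝ))]
  exact ff_intOn'.union ff_intOn

lemma hasSum_congr_aux {f g : ℕ → ℂ} {L : ℂ} (h : ∀ k, f k = g k) (hg : HasSum g L) :
    HasSum f L := by
  rw [funext h]; exact hg

lemma ff_series {x : ℝ} (hx : 0 < x) (s : ℂ) :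
    HasSum (fun k : ℕ => Complex.exp ((s - (3 * k + 1) * (2 * π / Real.sqrt 3 : ℝ)) * x)
      - Complex.exp ((s - (3 * k + 2) * (2 * π / Real.sqrt 3 : ℝ)) * x))
      (Complex.exp (s * x) * ff x) := by
  set c := 2 * π / Real.sqrt 3 with hc
  have hcp : 0 < c := cpos
  set q := Real.exp (-(c * x)) with hq
  have hq0 : 0 < q := Real.exp_pos _
  have hq1 : q < 1 := by
    rw [hq, Real.exp_lt_one_iff]; have := mul_pos hcp hx; linarith
  have hq3 : q ^ 3 < 1 := pow_lt_one₀ hq0.le hq1 (by norm_num)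
  have hg := hasSum_geometric_of_lt_one (by positivity : 0 ≤ q ^ 3) hq3
  have hg2 := ((Complex.hasSum_ofReal.mpr (hg.mul_left (q - q ^ 2)))).mul_left
    (Complex.exp (s * x))
  have hfq : ff x = (q - q ^ 2) * (1 - q ^ 3)⁻¹ := by
    unfold ff
    rw [show 2 * π * x / Real.sqrt 3 = c * x by rw [hc]; ring, Real.cosh_eq,
      show Real.exp (c * x) = q⁻¹ by rw [hq, Real.exp_neg, inv_inv], ← hq]
    have h1 : 1 - q ^ 3 ≠ 0 := by linarith
    have h2 : 1 + 2 * ((q⁻¹ + q) / 2) ≠ 0 := by positivity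
    rw [← div_eq_mul_inv, div_eq_div_iff h2 h1]
    field_simp
    ring
  rw [hfq]
  refine hasSum_congr_aux (fun k => ?_) hg2
  have hqc : (q : ℂ) = Complex.exp (-(c * x)) := by rw [hq]; push_cast; rfl
  have p1 : Complex.exp ((s - (3 * k + 1) * (c : ℂ)) * x) =
      Complex.exp (s * x) * (q : ℂ) ^ (3 * k + 1) := by
    rw [hqc, ← Complex.exp_nat_mul, ← Complex.exp_add]
    congr 1; push_cast; ring
  have p2 : Complex.exp ((s - (3 * k + 2) * (c : ℂ)) * x) =
      Complex.exp (s * x) * (q : ℂ) ^ (3 * k + 2) := by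
    rw [hqc, ← Complex.exp_nat_mul, ← Complex.exp_add]
    congr 1; push_cast; ring
  rw [p1, p2]
  push_cast
  ring

lemma half_FT (s : ℂ) (hs : s.re = 0) :
    HasSum (fun k : ℕ => 1 / ((3 * k + 1) * ((2 * π / Real.sqrt 3 : ℝ) : ℂ) - s)
      - 1 / ((3 * k + 2) * ((2 * π / Real.sqrt 3 : ℝ) : ℂ) - s))
      (∫ x in Set.Ioi (0:ℝ), Complex.exp (s * x) * ff x) := by
  set c := 2 * π / Real.sqrt 3 with hc
  have hcp : 0 < c := cpos
  have hre1 (k : ℕ) : (s - (3 * k + 1) * (c : ℂ)).re < 0 := by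
    have : (s - (3 * k + 1) * (c : ℂ)).re = - ((3 * k + 1) * c) := by simp [hs]
    rw [this]; have : 0 < (3 * (k:ℝ) + 1) * c := by positivity
    linarith
  have hre2 (k : ℕ) : (s - (3 * k + 2) * (c : ℂ)).re < 0 := by
    have : (s - (3 * k + 2) * (c : ℂ)).re = - ((3 * k + 2) * c) := by simp [hs]
    rw [this]; have : 0 < (3 * (k:ℝ) + 2) * c := by positivity
    linarith
  have hint (k : ℕ) : Integrable (fun x : ℝ => Complex.exp ((s - (3 * k + 1) * (c : ℂ)) * x)
      - Complex.exp ((s - (3 * k + 2) * (c : ℂ)) * x)) (volume.restrict (Set.Ioi 0)) :=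
    (integrableOn_exp_mul_complex_Ioi (hre1 k) 0).sub (integrableOn_exp_mul_complex_Ioi (hre2 k) 0)
  have hnorm (k : ℕ) : ∫ x in Set.Ioi (0:ℝ), ‖Complex.exp ((s - (3 * k + 1) * (c : ℂ)) * x)
      - Complex.exp ((s - (3 * k + 2) * (c : ℂ)) * x)‖ =
      1 / ((3 * k + 1) * c) - 1 / ((3 * k + 2) * c) := by
    have n1 : -((3 * (k:ℝ) + 1) * c) < 0 := by
      have : 0 < (3 * (k:ℝ) + 1) * c := by positivity
      linarith
    have n2 : -((3 * (k:ℝ) + 2) * c) < 0 := by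
      have : 0 < (3 * (k:ℝ) + 2) * c := by positivity
      linarith
    have : ∀ x ∈ Set.Ioi (0:ℝ), ‖Complex.exp ((s - (3 * k + 1) * (c : ℂ)) * x)
      - Complex.exp ((s - (3 * k + 2) * (c : ℂ)) * x)‖ =
      Real.exp (-((3 * k + 1) * c) * x) - Real.exp (-((3 * k + 2) * c) * x) := by
      intro x hx
      have hx : 0 < x := hx
      have e1 : Complex.exp ((s - (3 * k + 1) * (c : ℂ)) * x)
        - Complex.exp ((s - (3 * k + 2) * (c : ℂ)) * x) =
        Complex.exp (s * x) *
          ((Real.exp (-((3 * k + 1) * c) * x) - Real.exp (-((3 * k + 2) * c) * x) : ℝ) : ℂ) := by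
        push_cast
        rw [mul_sub, ← Complex.exp_add, ← Complex.exp_add]
        congr 2 <;> ring
      rw [e1, norm_mul, Complex.norm_exp, Complex.norm_real, Real.norm_of_nonneg]
      · simp [hs]
      · rw [sub_nonneg, Real.exp_le_exp]
        have := mul_pos hcp hx
        nlinarith
    rw [setIntegral_congr_fun measurableSet_Ioi this, integral_sub
      (integrableOn_exp_mul_Ioi n1 0) (integrableOn_exp_mul_Ioi n2 0),
      integral_exp_mul_Ioi n1, integral_exp_mul_Ioi n2]
    simp [neg_div_neg_eq]
  have hsum : Summable (fun k : ℕ => ∫ x in Set.Ioi (0:ℝ),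
      ‖Complex.exp ((s - (3 * k + 1) * (c : ℂ)) * x)
      - Complex.exp ((s - (3 * k + 2) * (c : ℂ)) * x)‖) := by
    simp_rw [hnorm]
    have h2 : Summable (fun k : ℕ => (1 / c) * (1 / ((k + 1 : ℕ) : ℝ) ^ 2)) :=
      ((summable_nat_add_iff 1).mpr (Real.summable_one_div_nat_pow.mpr one_lt_two)).mul_left _
    refine Summable.of_nonneg_of_le (fun k => ?_) (fun k => ?_) h2
    · rw [sub_nonneg]
      apply one_div_le_one_div_of_le (by positivity)
      nlinarith
    · have : 1 / ((3 * (k:ℝ) + 1) * c) - 1 / ((3 * k + 2) * c) =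
        (1 / c) * (1 / ((3 * k + 1) * (3 * k + 2))) := by
        field_simp; ring
      rw [this]
      apply mul_le_mul_of_nonneg_left _ (by positivity)
      apply one_div_le_one_div_of_le (by positivity)
      push_cast
      have : (0:ℝ) ≤ k := k.cast_nonneg
      nlinarith
  have key := hasSum_integral_of_summable_integral_norm hint hsum
  have e : ∫ x in Set.Ioi (0:ℝ), Complex.exp (s * x) * ff x =
      ∫ x in Set.Ioi (0:ℝ), ∑' k : ℕ, (Complex.exp ((s - (3 * k + 1) * (c : ℂ)) * x)
      - Complex.exp ((s - (3 * k + 2) * (c : ℂ)) * x)) := by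
    refine setIntegral_congr_fun measurableSet_Ioi (fun x hx => ?_)
    exact (ff_series hx s).tsum_eq.symm
  rw [e]
  refine hasSum_congr_aux (fun k => ?_) key
  rw [integral_sub (integrableOn_exp_mul_complex_Ioi (hre1 k) 0)
    (integrableOn_exp_mul_complex_Ioi (hre2 k) 0), integral_exp_mul_complex_Ioi (hre1 k),
    integral_exp_mul_complex_Ioi (hre2 k)]
  simp only [Complex.ofReal_zero, mul_zero, Complex.exp_zero]
  rw [← neg_sub s, ← neg_sub s, one_div_neg_eq_neg_one_div, one_div_neg_eq_neg_one_div,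
    neg_div, neg_div]

open Filter Topology in
lemma cot_sum (x : ℂ) (hx : x ∈ Complex.integerComplement) :
    Tendsto (fun n : ℕ => ∑ k ∈ Finset.range n, (1 / (x + k) - 1 / (k + 1 - x))) atTop
      (𝓝 (π * Complex.cot (π * x))) := by
  have h1 := (summable_cotTerm hx).hasSum
  have h2 := cot_series_rep' hx
  have h3 : HasSum (fun n : ℕ => 1 / (x - (n + 1)) + 1 / (x + (n + 1)))
      (π * Complex.cot (π * x) - 1 / x) := by
    rw [h2]; exact h1
  have t2 := (h3.tendsto_sum_nat).const_add (1 / x)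
  have t3 : Tendsto (fun n : ℕ => 1 / (x + n)) atTop (𝓝 0) := by
    simp only [one_div]
    apply tendsto_inv₀_cobounded.comp
    rw [← tendsto_norm_atTop_iff_cobounded]
    refine tendsto_atTop_mono (f := fun n : ℕ => (n : ℝ) - ‖x‖) (fun n => ?_)
      (tendsto_atTop_add_const_right _ _ tendsto_natCast_atTop_atTop)
    have := norm_sub_le (x + n) x
    simp at this
    linarith
  have : ∀ n : ℕ, (∑ k ∈ Finset.range n, (1 / (x + k) - 1 / (k + 1 - x))) + 1 / (x + n) =
      1 / x + ∑ k ∈ Finset.range n, (1 / (x - (k + 1)) + 1 / (x + (k + 1))) := by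
    intro n
    induction n with
    | zero => simp
    | succ n ih =>
      rw [Finset.sum_range_succ, Finset.sum_range_succ, ← add_assoc, ← ih]
      rw [← neg_sub x, one_div_neg_eq_neg_one_div]
      push_cast
      ring
  have t5 := (t2.congr (fun n => (this n).symm)).sub t3
  simpa using t5

lemma trig_id (y : ℝ) :
    Complex.cot (π / 3 + y * Complex.I) + Complex.cot (π / 3 - y * Complex.I) =
      ((2 * Real.sqrt 3 / (1 + 2 * Real.cosh (2 * y)) : ℝ) : ℂ) := by
  have s3 : Complex.sin (π / 3) = (Real.sqrt 3 : ℂ) / 2 := by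
    rw [show (π / 3 : ℂ) = ((π / 3 : ℝ) : ℂ) by push_cast; rfl, ← Complex.ofReal_sin,
      Real.sin_pi_div_three]; push_cast; rfl
  have c3 : Complex.cos (π / 3) = 1 / 2 := by
    rw [show (π / 3 : ℂ) = ((π / 3 : ℝ) : ℂ) by push_cast; rfl, ← Complex.ofReal_cos,
      Real.cos_pi_div_three]; push_cast; rfl
  have hr : (Real.sqrt 3 : ℂ) ^ 2 = 3 := by
    rw [← Complex.ofReal_pow, Real.sq_sqrt (by norm_num)]; norm_num
  have hCH : Complex.cosh y ^ 2 - Complex.sinh y ^ 2 = 1 := Complex.cosh_sq_sub_sinh_sq _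
  have hI := Complex.I_sq
  have hpos : (0:ℝ) < 3 * Real.cosh y ^ 2 + Real.sinh y ^ 2 := by
    have := Real.cosh_pos y; positivity
  have hne : 3 * Complex.cosh y ^ 2 + Complex.sinh y ^ 2 ≠ 0 := by
    rw [← Complex.ofReal_cosh, ← Complex.ofReal_sinh]
    exact_mod_cast hpos.ne'
  have hd : (1 + 2 * Complex.cosh (2 * y)) = 3 * Complex.cosh y ^ 2 + Complex.sinh y ^ 2 := by
    rw [Complex.cosh_two_mul]; linear_combination -hCH
  rw [Complex.cot, Complex.cot, Complex.sin_add, Complex.sin_sub, Complex.cos_add,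
    Complex.cos_sub, Complex.sin_mul_I, Complex.cos_mul_I, s3, c3]
  push_cast
  rw [hd]
  set C := Complex.cosh y
  set H := Complex.sinh y
  set r := (Real.sqrt 3 : ℂ)
  set I := Complex.I
  have hprod : (r / 2 * C + 1 / 2 * (H * I)) * (r / 2 * C - 1 / 2 * (H * I)) =
      (3 * C ^ 2 + H ^ 2) / 4 := by
    linear_combination C ^ 2 / 4 * hr - H ^ 2 / 4 * hI
  have hp0 : (r / 2 * C + 1 / 2 * (H * I)) * (r / 2 * C - 1 / 2 * (H * I)) ≠ 0 := by
    rw [hprod]; exact div_ne_zero hne (by norm_num)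
  have ha := left_ne_zero_of_mul hp0
  have hb := right_ne_zero_of_mul hp0
  rw [div_add_div _ _ ha hb, hprod, div_eq_div_iff (div_ne_zero hne (by norm_num)) hne]
  linear_combination (3 * C ^ 2 + H ^ 2) * (r / 2 * hCH + r * H ^ 2 / 2 * hI)

lemma x_mem (y : ℝ) : (1 / 3 + y * Complex.I : ℂ) ∈ Complex.integerComplement := by
  rintro ⟨m, hm⟩
  have := congrArg Complex.re hm
  simp at this
  have h2 : (3 * m : ℤ) = 1 := by
    have : (3 * m : ℝ) = 1 := by rw [this]; norm_num
    exact_mod_cast this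
  omega

lemma FT_sum (t : ℝ) :
    (∫ x in Set.Ioi (0:ℝ), Complex.exp ((2 * π * t * Complex.I) * x) * ff x) +
    (∫ x in Set.Ioi (0:ℝ), Complex.exp (-(2 * π * t * Complex.I) * x) * ff x) = ff t := by
  have h1 := half_FT (2 * π * t * Complex.I) (by simp)
  have h2 := half_FT (-(2 * π * t * Complex.I)) (by simp)
  have h3 := h1.add h2
  have y1 := cot_sum _ (x_mem (t / Real.sqrt 3))
  have y2 := cot_sum _ (x_mem (-(t / Real.sqrt 3)))
  have y3 := (y1.add y2).const_mul ((Real.sqrt 3 : ℂ) / (6 * π))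
  have hpi : (π : ℂ) ≠ 0 := by exact_mod_cast Real.pi_ne_zero
  have hr0 : (Real.sqrt 3 : ℂ) ≠ 0 := by
    have : Real.sqrt 3 ≠ 0 := by positivity
    exact_mod_cast this
  have hr : (Real.sqrt 3 : ℂ) ^ 2 = 3 := by
    rw [← Complex.ofReal_pow, Real.sq_sqrt (by norm_num)]; norm_num
  have trig := trig_id (π * t / Real.sqrt 3)
  have e : (Real.sqrt 3 : ℂ) / (6 * π) * (π * Complex.cot (π * (1 / 3 + (t / Real.sqrt 3 : ℝ) * Complex.I))
      + π * Complex.cot (π * (1 / 3 + (-(t / Real.sqrt 3) : ℝ) * Complex.I))) = ff t := by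
    rw [show (π * (1 / 3 + (t / Real.sqrt 3 : ℝ) * Complex.I) : ℂ) =
      π / 3 + (π * t / Real.sqrt 3 : ℝ) * Complex.I by push_cast; ring,
      show (π * (1 / 3 + (-(t / Real.sqrt 3) : ℝ) * Complex.I) : ℂ) =
      π / 3 - (π * t / Real.sqrt 3 : ℝ) * Complex.I by push_cast; ring, ← mul_add, trig]
    unfold ff
    rw [show 2 * (π * t / Real.sqrt 3) = 2 * π * t / Real.sqrt 3 by ring]
    have hd := (ff_den_pos t).ne'
    set D := 1 + 2 * Real.cosh (2 * π * t / Real.sqrt 3)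
    have hd' : (D : ℂ) ≠ 0 := by exact_mod_cast hd
    push_cast
    field_simp
    linear_combination 2 * hr
  rw [e] at y3
  refine tendsto_nhds_unique h3.tendsto_sum_nat (y3.congr fun n => ?_)
  rw [← Finset.sum_add_distrib, Finset.mul_sum]
  refine Finset.sum_congr rfl (fun k _ => ?_)
  have key : ∀ (a b : ℂ), a = (6 * π / Real.sqrt 3) * b →
      1 / a = (Real.sqrt 3 : ℂ) / (6 * π) * (1 / b) := by
    intro a b hab
    rw [hab, one_div, mul_inv, inv_div, one_div]
  rw [mul_add, mul_sub, mul_sub, ← key _ _ rfl, ← key _ _ rfl, ← key _ _ rfl, ← key _ _ rfl]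
  have d1 : (6 * π / Real.sqrt 3) * (1 / 3 + (t / Real.sqrt 3 : ℝ) * Complex.I + k) =
      (3 * k + 1) * ((2 * π / Real.sqrt 3 : ℝ) : ℂ) - -(2 * π * t * Complex.I) := by
    push_cast; field_simp; linear_combination -6 * t * Complex.I * hr
  have d2 : (6 * π / Real.sqrt 3) * (k + 1 - (1 / 3 + (t / Real.sqrt 3 : ℝ) * Complex.I)) =
      (3 * k + 2) * ((2 * π / Real.sqrt 3 : ℝ) : ℂ) - (2 * π * t * Complex.I) := by
    push_cast; field_simp; linear_combination 6 * t * Complex.I * hr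
  have d3 : (6 * π / Real.sqrt 3) * (1 / 3 + (-(t / Real.sqrt 3) : ℝ) * Complex.I + k) =
      (3 * k + 1) * ((2 * π / Real.sqrt 3 : ℝ) : ℂ) - (2 * π * t * Complex.I) := by
    push_cast; field_simp; linear_combination 6 * t * Complex.I * hr
  have d4 : (6 * π / Real.sqrt 3) * (k + 1 - (1 / 3 + (-(t / Real.sqrt 3) : ℝ) * Complex.I)) =
      (3 * k + 2) * ((2 * π / Real.sqrt 3 : ℝ) : ℂ) - -(2 * π * t * Complex.I) := by
    push_cast; field_simp; linear_combination -6 * t * Complex.I * hr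
  rw [d1, d2, d3, d4]
  ring

lemma ff_FT : FourierTransform.fourier (fun x : ℝ => (ff x : ℂ)) = fun t => (ff t : ℂ) := by
  ext t
  rw [Real.fourier_real_eq_integral_exp_smul, ← FT_sum]
  have hint : Integrable (fun x : ℝ => Complex.exp (↑(-2 * π * x * t) * Complex.I) • (ff x : ℂ)) := by
    refine ff_int.mono' (Continuous.aestronglyMeasurable ?_) ?_
    · have := ff_cont
      fun_prop
    · filter_upwards with x
      rw [smul_eq_mul, norm_mul, Complex.norm_exp_ofReal_mul_I, Complex.norm_real, one_mul,
        Real.norm_of_nonneg (ff_nonneg x)]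
  rw [← intervalIntegral.integral_Iic_add_Ioi hint.integrableOn hint.integrableOn (b := 0)]
  congr 1
  · rw [← neg_zero, ← integral_comp_neg_Ioi, neg_zero]
    refine setIntegral_congr_fun measurableSet_Ioi (fun x _ => ?_)
    simp only [ff_neg, smul_eq_mul]
    congr 2
    push_cast; ring
  · refine setIntegral_congr_fun measurableSet_Ioi (fun x _ => ?_)
    simp only [smul_eq_mul]
    congr 2
    push_cast; ring

open Complex in
lemma parseval {b : ℂ} (hb : 0 < b.re) :
    ∫ x : ℝ, (ff x : ℂ) * cexp (-π * b * x ^ 2) =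
      1 / b ^ (1 / 2 : ℂ) * ∫ x : ℝ, (ff x : ℂ) * cexp (-π / b * x ^ 2) := by
  have hg : Integrable (fun x : ℝ => cexp (-π * b * x ^ 2)) := by
    have := integrable_cexp_quadratic' (b := -π * b)
      (by simpa using mul_pos Real.pi_pos hb) 0 0
    simpa using this
  have h := VectorFourier.integral_fourierIntegral_smul_eq_flip (L := innerₗ ℝ)
    (μ := volume) (ν := volume) (e := Real.fourierChar) Real.continuous_fourierChar
    continuous_inner ff_int.ofReal (𝕜 := ℝ) hg
  have e1 : VectorFourier.fourierIntegral Real.fourierChar volume (innerₗ ℝ)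
    (fun x : ℝ => (ff x : ℂ)) = fun t => (ff t : ℂ) := ff_FT
  have e2 : VectorFourier.fourierIntegral Real.fourierChar volume (innerₗ ℝ).flip
    (fun x : ℝ => cexp (-π * b * x ^ 2)) =
      fun t : ℝ ↦ 1 / b ^ (1 / 2 : ℂ) * cexp (-π / b * t ^ 2) := by
    rw [flip_innerₗ]; exact fourier_gaussian_pi hb
  erw [e1, e2] at h
  simp only [smul_eq_mul] at h
  rw [h, ← integral_const_mul]
  congr 1; ext x; rw [mul_left_comm]; rfl

open Filter Topology Complex in
lemma limit_id (n : ℝ) (hn : 0 < n) :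
    ∫ x : ℝ, (ff x : ℂ) * cexp (-π * (-n * I) * x ^ 2) =
      1 / (-n * I : ℂ) ^ (1 / 2 : ℂ) * ∫ x : ℝ, (ff x : ℂ) * cexp (-π / (-n * I) * x ^ 2) := by
  have hb : Tendsto (fun ε : ℝ => (ε - n * I : ℂ)) (𝓝[>] 0) (𝓝 (-n * I)) := by
    have : Continuous (fun ε : ℝ => (ε - n * I : ℂ)) := by fun_prop
    have := (this.tendsto 0).mono_left (nhdsWithin_le_nhds (s := Set.Ioi 0))
    simpa using this
  have hn0 : (-n * I : ℂ) ≠ 0 := by simp [hn.ne']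
  have hpos : ∀ᶠ ε : ℝ in 𝓝[>] 0, 0 < (ε - n * I : ℂ).re := by
    filter_upwards [self_mem_nhdsWithin] with ε hε
    simpa using hε
  have hint := ff_int
  have L1 : Tendsto (fun ε : ℝ => ∫ x : ℝ, (ff x : ℂ) * cexp (-π * (ε - n * I) * x ^ 2)) (𝓝[>] 0)
      (𝓝 (∫ x : ℝ, (ff x : ℂ) * cexp (-π * (-n * I) * x ^ 2))) := by
    refine tendsto_integral_filter_of_dominated_convergence ff ?_ ?_ hint ?_
    · filter_upwards with ε
      refine Continuous.aestronglyMeasurable ?_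
      have := ff_cont
      fun_prop
    · filter_upwards [hpos] with ε hε
      filter_upwards with x
      rw [norm_mul, Complex.norm_real, Real.norm_of_nonneg (ff_nonneg x), Complex.norm_exp]
      refine mul_le_of_le_one_right (ff_nonneg x) (Real.exp_le_one_iff.mpr ?_)
      rw [show (-π * (ε - n * I) * x ^ 2 : ℂ) = ((-(π * x ^ 2) : ℝ) : ℂ) * (ε - n * I) by
        push_cast; ring, re_ofReal_mul]
      have : 0 ≤ π * x ^ 2 := by positivity
      nlinarith
    · filter_upwards with x
      exact (((hb.const_mul _).mul_const _).cexp).const_mul _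
  have L2 : Tendsto (fun ε : ℝ => ∫ x : ℝ, (ff x : ℂ) * cexp (-π / (ε - n * I) * x ^ 2)) (𝓝[>] 0)
      (𝓝 (∫ x : ℝ, (ff x : ℂ) * cexp (-π / (-n * I) * x ^ 2))) := by
    refine tendsto_integral_filter_of_dominated_convergence ff ?_ ?_ hint ?_
    · filter_upwards with ε
      refine Continuous.aestronglyMeasurable ?_
      have := ff_cont
      fun_prop
    · filter_upwards [hpos] with ε hε
      filter_upwards with x
      rw [norm_mul, Complex.norm_real, Real.norm_of_nonneg (ff_nonneg x), Complex.norm_exp]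
      refine mul_le_of_le_one_right (ff_nonneg x) (Real.exp_le_one_iff.mpr ?_)
      rw [show (-π / (ε - n * I) * x ^ 2 : ℂ) = ((-(π * x ^ 2) : ℝ) : ℂ) * (ε - n * I)⁻¹ by
        push_cast; ring, re_ofReal_mul, inv_re]
      have : 0 ≤ π * x ^ 2 := by positivity
      have : 0 ≤ (ε - n * I : ℂ).re / normSq (ε - n * I : ℂ) :=
        div_nonneg hε.le (normSq_nonneg _)
      nlinarith
    · filter_upwards with x
      exact (((tendsto_const_nhds.div hb hn0).mul_const _).cexp).const_mul _
  have L3 : Tendsto (fun ε : ℝ => 1 / (ε - n * I : ℂ) ^ (1 / 2 : ℂ)) (𝓝[>] 0)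
      (𝓝 (1 / (-n * I : ℂ) ^ (1 / 2 : ℂ))) := by
    refine tendsto_const_nhds.div (hb.cpow tendsto_const_nhds ?_) ?_
    · right; simp [hn.ne']
    · simp [cpow_eq_zero_iff, hn.ne']
  refine tendsto_nhds_unique L1 ((L3.mul L2).congr' ?_)
  filter_upwards [hpos] with ε hε
  exact (parseval hε).symm

open Complex in
lemma split_int (a : ℝ) : ∫ x : ℝ, (ff x : ℂ) * cexp (((π * a * x ^ 2 : ℝ) : ℂ) * I) =
    ((2 * Phi2 a : ℝ) : ℂ) + ((2 * Psi2 a : ℝ) : ℂ) * I := by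
  have hint : Integrable (fun x : ℝ => (ff x : ℂ) * cexp (((π * a * x ^ 2 : ℝ) : ℂ) * I)) := by
    refine ff_int.mono' (Continuous.aestronglyMeasurable ?_) ?_
    · have := ff_cont
      fun_prop
    · filter_upwards with x
      rw [norm_mul, Complex.norm_exp_ofReal_mul_I, Complex.norm_real, mul_one,
        Real.norm_of_nonneg (ff_nonneg x)]
  have habs (x : ℝ) : ff |x| = ff x := by
    rcases abs_cases x with ⟨h, _⟩ | ⟨h, _⟩ <;> rw [h]
    exact ff_neg x
  rw [Phi2, Psi2, ← integral_comp_abs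
    (f := fun x => Real.cos (π * a * x ^ 2) / (1 + 2 * Real.cosh (2 * π * x / Real.sqrt 3))),
    ← integral_comp_abs
    (f := fun x => Real.sin (π * a * x ^ 2) / (1 + 2 * Real.cosh (2 * π * x / Real.sqrt 3)))]
  rw [← integral_re_add_im hint]
  congr 2
  · congr 2; ext x
    have := habs x
    unfold ff at this
    rw [div_eq_mul_one_div, this, sq_abs]
    change ((ff x : ℂ) * cexp (((π * a * x ^ 2 : ℝ) : ℂ) * I)).re = _
    rw [re_ofReal_mul, exp_ofReal_mul_I_re, ff, mul_comm]
  · congr 2; ext x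
    have := habs x
    unfold ff at this
    rw [div_eq_mul_one_div, this, sq_abs]
    change ((ff x : ℂ) * cexp (((π * a * x ^ 2 : ℝ) : ℂ) * I)).im = _
    rw [im_ofReal_mul, exp_ofReal_mul_I_im, ff, mul_comm]

open Complex in
theorem stmt2 (n : ℝ) (hn : 0 < n) :
    Phi2 n = Real.sqrt (2 / n) * Psi2 (1 / n) + Psi2 n := by
  have h := limit_id n hn
  have hnc : (n : ℂ) ≠ 0 := by exact_mod_cast hn.ne'
  have e1 : ∀ x : ℝ, (-π * (-n * I) * x ^ 2 : ℂ) = ((π * n * x ^ 2 : ℝ) : ℂ) * I := by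
    intro x; push_cast; ring
  have e2 : ∀ x : ℝ, (-π / (-n * I) * x ^ 2 : ℂ) = ((π * (-(1 / n)) * x ^ 2 : ℝ) : ℂ) * I := by
    intro x; push_cast; field_simp; simp
  simp_rw [e1, e2] at h
  rw [split_int, split_int] at h
  have n1 : Phi2 (-(1 / n)) = Phi2 (1 / n) := by
    unfold Phi2
    congr 1; ext x
    rw [show π * (-(1 / n)) * x ^ 2 = -(π * (1 / n) * x ^ 2) by ring, Real.cos_neg]
  have n2 : Psi2 (-(1 / n)) = -Psi2 (1 / n) := by
    unfold Psi2
    rw [← integral_neg]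
    congr 1; ext x
    rw [show π * (-(1 / n)) * x ^ 2 = -(π * (1 / n) * x ^ 2) by ring, Real.sin_neg, neg_div]
  rw [n1, n2] at h
  set r := Real.sqrt (2 / n) with hr
  have hr0 : 0 < r := Real.sqrt_pos.mpr (by positivity)
  have hr2 : r ^ 2 * n = 2 := by
    rw [hr, Real.sq_sqrt (by positivity)]; field_simp
  have hroot : (-n * I : ℂ) ^ (1 / 2 : ℂ) = (((1 / r : ℝ) : ℂ) * (1 - I)) := by
    have hsq : (((1 / r : ℝ) : ℂ) * (1 - I)) ^ 2 = -n * I := by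
      have : (n : ℂ) = ((2 * (1 / r) ^ 2 : ℝ) : ℂ) := by
        congr 1; field_simp; linarith
      rw [this]; push_cast
      linear_combination ((1 / r : ℂ)) ^ 2 * I_sq
    rw [← hsq, one_div (2:ℂ), sq_cpow_two_inv]
    simpa using hr0
  have hinv : 1 / (-n * I : ℂ) ^ (1 / 2 : ℂ) = ((r / 2 : ℝ) : ℂ) * (1 + I) := by
    have hrc : (r : ℂ) ≠ 0 := by exact_mod_cast hr0.ne'
    rw [hroot, div_eq_iff]
    · push_cast; field_simp
      linear_combination I_sq
    · rw [← hroot]; simp [cpow_eq_zero_iff, hn.ne']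
  rw [hinv] at h
  have hre := congrArg Complex.re h
  have him := congrArg Complex.im h
  simp at hre him
  rw [one_div]
  linarith
end

section
/- For every real number n > 0, ∫₀^∞ sin(π n x)/(exp(2π√x) − 1) dx = (1/n)·√(2/n)·Φ₃(1/n) + Φ₃(n) − 1/(2π n), where Φ₃(a) = ∫₀^∞ cos(π a x)/(exp(2π√x) − 1) dx. -/
open Real MeasureTheory

noncomputable def Phi3 (a : ℝ) : ℝ :=
  ∫ x in Set.Ioi (0:ℝ), Real.cos (π * a * x) / (Real.exp (2 * π * Real.sqrt x) - 1)

noncomputable def Psi3 (a : ℝ) : ℝ :=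
  1 / (2 * π * a) + ∫ x in Set.Ioi (0:ℝ), Real.sin (π * a * x) / (Real.exp (2 * π * Real.sqrt x) - 1)

lemma den_ge {t : ℝ} (ht : 0 < t) : 2 * π * t * rexp (π * t) ≤ rexp (2 * π * t) - 1 := by
  have h1 : π * t ≤ Real.sinh (π * t) := Real.self_le_sinh_iff.2 (by positivity)
  rw [Real.sinh_eq] at h1
  have h2 : rexp (2 * π * t) = rexp (π * t) * rexp (π * t) := by rw [← Real.exp_add]; ring_nf
  have h3 : rexp (π * t) * rexp (-(π * t)) = 1 := by rw [← Real.exp_add]; simp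
  have h4 := Real.exp_pos (π * t)
  nlinarith

lemma den_pos {t : ℝ} (ht : 0 < t) : 0 < rexp (2 * π * t) - 1 :=
  lt_of_lt_of_le (by positivity) (den_ge ht)

noncomputable def hh (t : ℝ) : ℝ := t / (rexp (2 * π * t) - 1)

lemma hh_nonneg {t : ℝ} (ht : 0 < t) : 0 ≤ hh t := div_nonneg ht.le (den_pos ht).le

lemma hh_meas : Measurable hh := by unfold hh; fun_prop

lemma hh_int : IntegrableOn hh (Set.Ioi 0) := by
  have h := (integrableOn_exp_mul_Ioi (a := -π) (by linarith [Real.pi_pos]) 0).const_mul (1 / (2 * π))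
  refine Integrable.mono' h hh_meas.aestronglyMeasurable ?_
  filter_upwards [ae_restrict_mem measurableSet_Ioi] with t ht
  have ht : 0 < t := ht
  rw [Real.norm_of_nonneg (hh_nonneg ht), hh, div_le_iff₀ (den_pos ht)]
  have := den_ge ht
  have h3 : rexp (π * t) * rexp (-π * t) = 1 := by rw [← Real.exp_add]; simp
  have h5 : 0 < 1 / (2 * π) * rexp (-π * t) := by positivity
  calc t = 1 / (2 * π) * rexp (-π * t) * (2 * π * t * rexp (π * t)) := by
        have : 1 / (2 * π) * rexp (-π * t) * (2 * π * t * rexp (π * t)) = t * (rexp (π * t) * rexp (-π * t)) := by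
          generalize rexp (-π * t) = A; field_simp
        rw [this, h3, mul_one]
    _ ≤ _ := mul_le_mul_of_nonneg_left this h5.le

noncomputable def FF (s : ℂ) : ℂ := ∫ t in Set.Ioi (0:ℝ), Complex.exp (-(π * s) * (t:ℂ)^2) * (hh t : ℂ)

lemma gauss_sin {s : ℂ} (hs : 0 < s.re) (u : ℝ) :
    ∫ t in Set.Ioi (0:ℝ), (t:ℂ) * Complex.exp (-(π * s) * (t:ℂ)^2) * (Real.sin (2 * π * t * u) : ℂ)
     = (1/2) * (u / s) * (1 / s) ^ (1/2 : ℂ) * Complex.exp (-(π * s⁻¹) * (u:ℂ)^2) := by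
  have hs0 : s ≠ 0 := by rintro rfl; simp at hs
  have hpi : (π : ℂ) ≠ 0 := by exact_mod_cast Real.pi_ne_zero
  have hb : 0 < ((π : ℂ) * s).re := by
    rw [Complex.re_ofReal_mul]; exact mul_pos Real.pi_pos hs
  set f : ℝ → ℂ := fun t => Complex.exp (Complex.I * (2 * π * u) * t) * Complex.exp (-(π * s) * (t:ℂ)^2) with hf
  have hfint : ∫ t, f t = (1 / s) ^ (1/2 : ℂ) * Complex.exp (-(π * s⁻¹) * (u:ℂ)^2) := by
    rw [hf, fourierIntegral_gaussian hb]
    congr 2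
    · field_simp
    · field_simp; ring
  have hfI : Integrable f := by
    refine (integrable_cexp_neg_mul_sq hb).bdd_mul (c := 1) (by fun_prop) ?_
    filter_upwards with t
    rw [show Complex.I * (2 * π * u) * t = ((2 * π * u * t : ℝ) : ℂ) * Complex.I by push_cast; ring,
      Complex.norm_exp_ofReal_mul_I]
  have htf : Integrable (fun t : ℝ => (t:ℂ) * f t) := by
    have : Integrable (fun t : ℝ => Complex.exp (Complex.I * (2 * π * u) * t) * ((t:ℂ) * Complex.exp (-(π * s) * (t:ℂ)^2))) := by
      refine (integrable_mul_cexp_neg_mul_sq hb).bdd_mul (c := 1) (by fun_prop) ?_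
      filter_upwards with t
      rw [show Complex.I * (2 * π * u) * t = ((2 * π * u * t : ℝ) : ℂ) * Complex.I by push_cast; ring,
        Complex.norm_exp_ofReal_mul_I]
    refine this.congr ?_
    filter_upwards with t
    simp only [hf]; ring
  have hder : ∀ t : ℝ, HasDerivAt f (Complex.I * (2 * π * u) * f t - (2 * π * s) * (t * f t)) t := by
    intro t
    have h1 : HasDerivAt (fun z : ℂ => Complex.exp (Complex.I * (2 * π * u) * z) * Complex.exp (-(π * s) * z^2))
       (Complex.I * (2 * π * u) * f t - (2 * π * s) * (t * f t)) (t:ℂ) := by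
      have e1 := ((hasDerivAt_id' (t:ℂ)).const_mul (Complex.I * (2 * π * u))).cexp
      have e2 := (((hasDerivAt_id' (t:ℂ)).pow 2).const_mul (-(π * s))).cexp
      refine (e1.mul e2).congr_deriv ?_
      simp only [hf, Pi.pow_apply]; push_cast; ring
    exact h1.comp_ofReal
  have hz := integral_eq_zero_of_hasDerivAt_of_integrable hder
    ((hfI.const_mul _).sub (htf.const_mul _)) hfI
  rw [integral_sub (hfI.const_mul _) (htf.const_mul _), integral_const_mul, integral_const_mul] at hz
  have hsplit : ∫ t : ℝ, (t:ℂ) * f t = 2 * Complex.I * ∫ t in Set.Ioi (0:ℝ), (t:ℂ) * Complex.exp (-(π * s) * (t:ℂ)^2) * (Real.sin (2 * π * t * u) : ℂ) := by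
    rw [← intervalIntegral.integral_Iic_add_Ioi (b := 0) htf.integrableOn htf.integrableOn,
      show (Set.Iic (0:ℝ)) = Set.Iic (-0) by simp, ← integral_comp_neg_Ioi,
      ← integral_add, ← integral_const_mul]
    · refine integral_congr_ae ?_
      filter_upwards with t
      simp only [hf]
      push_cast
      rw [Complex.sin]
      rw [show Complex.I * (2 * π * u) * -(t:ℂ) = -(2 * π * t * u) * Complex.I by ring,
        show Complex.I * (2 * π * u) * (t:ℂ) = (2 * π * t * u) * Complex.I by ring, neg_sq]
      linear_combination ((t:ℂ) * Complex.exp (-(π * s) * (t:ℂ)^2) * (Complex.exp ((2 * π * t * u) * Complex.I) - Complex.exp (-(2 * π * t * u) * Complex.I))) * Complex.I_sq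
    · have := htf.comp_neg
      exact this.integrableOn
    · exact htf.integrableOn
  rw [hsplit, hfint] at hz
  have hI := Complex.I_ne_zero
  set X := ∫ t in Set.Ioi (0:ℝ), (t:ℂ) * Complex.exp (-(π * s) * (t:ℂ)^2) * (Real.sin (2 * π * t * u) : ℂ)
  generalize (1 / s) ^ (1/2 : ℂ) = C at *
  generalize Complex.exp (-(π * s⁻¹) * (u:ℂ)^2) = E at *
  have : (2 * Complex.I * 2 * π * s) * X = (2 * Complex.I * 2 * π * s) * ((1/2) * (u / s) * C * E) := by
    have hus : (u:ℂ) / s * s = u := div_mul_cancel₀ _ hs0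
    linear_combination -hz - 2 * Complex.I * π * C * E * hus
  exact mul_left_cancel₀ (by simp [hs0, hpi]) this

lemma sin_term (k : ℕ) (t : ℝ) : ∫ u in Set.Ioi (0:ℝ), rexp (-(2 * π * (k+1)) * u) * Real.sin (2 * π * t * u)
    = t / (2 * π * ((k+1)^2 + t^2)) := by
  have hre : (⟨-(2 * π * (k+1)), 2 * π * t⟩ : ℂ).re < 0 := by
    show -(2 * π * (k+1)) < 0
    have : 0 < 2 * π * ((k:ℝ)+1) := by positivity
    linarith
  have h := integral_exp_mul_complex_Ioi hre 0
  have hI := integrableOn_exp_mul_complex_Ioi hre 0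
  have h2 := congrArg Complex.im h
  rw [← Complex.imCLM_apply, ← Complex.imCLM.integral_comp_comm hI] at h2
  have e : ∀ u : ℝ, Complex.imCLM (Complex.exp ((⟨-(2 * π * (k+1)), 2 * π * t⟩ : ℂ) * u)) = rexp (-(2 * π * (k+1)) * u) * Real.sin (2 * π * t * u) := by
    intro u
    simp [Complex.exp_im]
  simp only [e] at h2
  rw [h2]
  simp [Complex.div_im, Complex.normSq_apply]
  field_simp

lemma cot_sum_s6 {t : ℝ} (ht : 0 < t) : ∑' k : ℕ, t / (2 * π * ((k+1)^2 + t^2)) = (1/2) * (1 / (rexp (2 * π * t) - 1) + 1/2 - 1 / (2 * π * t)) := by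
  have hz : Complex.I * t ∈ Complex.integerComplement :=
    UpperHalfPlane.coe_mem_integerComplement ⟨Complex.I * t, by simpa using ht⟩
  have h := cot_series_rep' hz
  have hI := Complex.I_ne_zero
  have ht' : (t:ℂ) ≠ 0 := by exact_mod_cast ht.ne'
  have hpi : (π : ℂ) ≠ 0 := by exact_mod_cast Real.pi_ne_zero
  have e : ∀ k : ℕ, (1 / (Complex.I * t - (k + 1)) + 1 / (Complex.I * t + (k + 1))) = (-4 * π * Complex.I) * ((t / (2 * π * ((k+1)^2 + t^2)) : ℝ) : ℂ) := by
    intro k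
    have h1 : Complex.I * t - (k + 1) ≠ 0 := by
      intro h; have := congrArg Complex.im h; simp at this; exact ht.ne' this
    have h2 : Complex.I * t + (k + 1) ≠ 0 := by
      intro h; have := congrArg Complex.im h; simp at this; exact ht.ne' this
    have h3 : ((k:ℂ)+1)^2 + t^2 ≠ 0 := by
      have : (0:ℝ) < ((k:ℝ)+1)^2 + t^2 := by positivity
      exact_mod_cast this.ne'
    push_cast
    field_simp
    linear_combination (4 * Complex.I * t^3) * Complex.I_sq
  simp only [e] at h
  rw [tsum_mul_left, ← Complex.ofReal_tsum, Complex.cot_pi_eq_exp_ratio] at h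
  have e2 : Complex.exp (2 * π * Complex.I * (Complex.I * t)) = ((rexp (2 * π * t) : ℝ) : ℂ)⁻¹ := by
    rw [Complex.ofReal_exp, ← Complex.exp_neg]; congr 1; push_cast
    linear_combination (2 * π * t) * Complex.I_sq
  rw [e2] at h
  apply Complex.ofReal_injective
  have hd := (den_pos ht).ne'
  generalize (∑' k : ℕ, t / (2 * π * ((k+1)^2 + t^2)) : ℝ) = S at *
  have hE0 : ((rexp (2 * π * t) : ℝ) : ℂ) ≠ 0 := by exact_mod_cast (Real.exp_pos _).ne'
  have hd' : ((rexp (2 * π * t) : ℝ) : ℂ) - 1 ≠ 0 := by exact_mod_cast hd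
  push_cast [-Complex.ofReal_exp]
  generalize ((rexp (2 * π * t) : ℝ) : ℂ) = E at *
  have h5 : (1 - E⁻¹) ≠ 0 := by
    intro h; apply hd'; field_simp at h; simpa using h
  have : (-4 * π * Complex.I) * (S:ℂ) = (-4 * π * Complex.I) * ((1/2) * (1 / (E - 1) + 1/2 - 1 / (2 * π * t))) := by
    rw [← h]
    have i1 : Complex.I * (1 - E⁻¹) = Complex.I * (E - 1) / E := by field_simp
    rw [i1]
    have i2 : Complex.I⁻¹ = -Complex.I := Complex.inv_I
    field_simp
    simp only [Complex.I_sq]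
    ring
  exact mul_left_cancel₀ (by simp [hpi]) this

lemma geom {u : ℝ} (hu : 0 < u) :
    HasSum (fun k : ℕ => rexp (-(2 * π * (k+1)) * u)) (1 / (rexp (2 * π * u) - 1)) := by
  have hr1 : rexp (-(2 * π * u)) < 1 := by
    rw [Real.exp_lt_one_iff]; have : 0 < 2 * π * u := by positivity
    linarith
  have h := (hasSum_geometric_of_lt_one (Real.exp_pos _).le hr1).mul_left (rexp (-(2 * π * u)))
  have e1 : (fun k : ℕ => rexp (-(2 * π * (k+1)) * u)) = fun k : ℕ => rexp (-(2 * π * u)) * rexp (-(2 * π * u)) ^ k := by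
    ext k
    rw [← Real.exp_nat_mul, ← Real.exp_add]; ring_nf
  have e2 : 1 / (rexp (2 * π * u) - 1) = rexp (-(2 * π * u)) * (1 - rexp (-(2 * π * u)))⁻¹ := by
    have := (den_pos hu).ne'
    have h0 := (Real.exp_pos (2 * π * u)).ne'
    rw [Real.exp_neg]
    have h1 : 1 - (rexp (2 * π * u))⁻¹ = (rexp (2 * π * u) - 1) / rexp (2 * π * u) := by field_simp
    rw [h1]; field_simp
  rw [e1, e2]
  exact h

lemma sin_bd {t u : ℝ} (ht : 0 < t) (hu : 0 < u) : |Real.sin (2 * π * t * u)| ≤ 2 * π * t * u := by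
  have := Real.abs_sin_le_abs (x := 2 * π * t * u)
  rwa [abs_of_pos (a := 2 * π * t * u) (by positivity)] at this

lemma sin_transform {t : ℝ} (ht : 0 < t) :
    ∫ u in Set.Ioi (0:ℝ), Real.sin (2 * π * t * u) / (rexp (2 * π * u) - 1)
      = (1/2) * (1 / (rexp (2 * π * t) - 1) + 1/2 - 1 / (2 * π * t)) := by
  have key := hasSum_integral_of_dominated_convergence (μ := volume.restrict (Set.Ioi (0:ℝ)))
    (F := fun (k : ℕ) (u : ℝ) => rexp (-(2 * π * (k+1)) * u) * Real.sin (2 * π * t * u))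
    (f := fun u => Real.sin (2 * π * t * u) / (rexp (2 * π * u) - 1))
    (bound := fun k u => rexp (-(2 * π * (k+1)) * u) * (2 * π * t * u))
    (fun k => by fun_prop) ?_ ?_ ?_ ?_
  · rw [← key.tsum_eq, ← cot_sum_s6 ht]
    exact tsum_congr fun k => sin_term k t
  · intro k
    filter_upwards [ae_restrict_mem measurableSet_Ioi] with u hu
    rw [norm_mul, Real.norm_of_nonneg (Real.exp_pos _).le]
    exact mul_le_mul_of_nonneg_left (sin_bd ht hu) (Real.exp_pos _).le
  · filter_upwards [ae_restrict_mem measurableSet_Ioi] with u hu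
    exact ((geom hu).mul_right _).summable
  · refine (hh_int.const_mul (2 * π * t)).congr ?_
    filter_upwards [ae_restrict_mem measurableSet_Ioi] with u hu
    rw [((geom hu).mul_right _).tsum_eq, hh]; ring
  · filter_upwards [ae_restrict_mem measurableSet_Ioi] with u hu
    have := (geom hu).mul_right (Real.sin (2 * π * t * u))
    rwa [one_div_mul_eq_div] at this

lemma norm_gauss (s : ℂ) (t : ℝ) : ‖Complex.exp (-(π * s) * (t:ℂ)^2)‖ = rexp (-(π * s.re) * t^2) := by
  rw [norm_cexp_neg_mul_sq, Complex.re_ofReal_mul]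

lemma FF_int {s : ℂ} (hs : 0 ≤ s.re) :
    IntegrableOn (fun t : ℝ => Complex.exp (-(π * s) * (t:ℂ)^2) * (hh t : ℂ)) (Set.Ioi 0) := by
  refine Integrable.mono' hh_int (by have := hh_meas; fun_prop) ?_
  filter_upwards [ae_restrict_mem measurableSet_Ioi] with t ht
  rw [norm_mul, norm_gauss, Complex.norm_real, Real.norm_of_nonneg (hh_nonneg ht)]
  refine mul_le_of_le_one_left (hh_nonneg ht) ?_
  rw [Real.exp_le_one_iff]
  have : 0 ≤ π * s.re * t^2 := by positivity
  linarith

lemma FF_cont : ContinuousOn FF {s | 0 ≤ s.re} := by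
  refine continuousOn_of_dominated (bound := hh) ?_ ?_ hh_int ?_
  · intro s hs
    exact (FF_int hs).aestronglyMeasurable
  · intro s hs
    filter_upwards [ae_restrict_mem measurableSet_Ioi] with t ht
    rw [norm_mul, norm_gauss, Complex.norm_real, Real.norm_of_nonneg (hh_nonneg ht)]
    refine mul_le_of_le_one_left (hh_nonneg ht) ?_
    rw [Real.exp_le_one_iff]
    have : 0 ≤ π * s.re * t^2 := mul_nonneg (mul_nonneg Real.pi_pos.le hs) (sq_nonneg t)
    linarith
  · filter_upwards with t
    fun_prop

lemma FF_eq {s : ℂ} (hs : 0 < s.re) :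
    FF s + 1 / (4 * π * s) - (1 / s) ^ (1/2 : ℂ) / (4 * π) = (1 / s) ^ (1/2 : ℂ) / s * FF (1 / s) := by
  have hs0 : s ≠ 0 := by rintro rfl; simp at hs
  have hpi : (π : ℂ) ≠ 0 := by exact_mod_cast Real.pi_ne_zero
  have hb : 0 < ((π : ℂ) * s).re := by
    rw [Complex.re_ofReal_mul]; exact mul_pos Real.pi_pos hs
  have hb' : 0 < π * s.re := mul_pos Real.pi_pos hs
  set G : ℝ → ℝ → ℂ := fun t u => (t:ℂ) * Complex.exp (-(π * s) * (t:ℂ)^2) *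
    (Real.sin (2 * π * t * u) : ℂ) * ((1 / (rexp (2 * π * u) - 1) : ℝ) : ℂ) with hG
  have hGint : Integrable (Function.uncurry G)
      ((volume.restrict (Set.Ioi (0:ℝ))).prod (volume.restrict (Set.Ioi (0:ℝ)))) := by
    have h1 : Integrable (fun t : ℝ => t ^ (2:ℝ) * rexp (-(π * s.re) * t^2)) (volume.restrict (Set.Ioi (0:ℝ))) :=
      (integrable_rpow_mul_exp_neg_mul_sq hb' (by norm_num)).integrableOn
    have h2 := h1.mul_prod (hh_int.const_mul (2 * π))
    refine Integrable.mono' h2 ?_ ?_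
    · apply Measurable.aestronglyMeasurable
      simp only [hG, Function.uncurry_def]
      fun_prop
    · rw [Measure.prod_restrict]
      filter_upwards [ae_restrict_mem (measurableSet_Ioi.prod measurableSet_Ioi)] with p hp
      obtain ⟨t, u⟩ := p
      have ht : 0 < t := hp.1
      have hu : 0 < u := hp.2
      simp only [hG, Function.uncurry_apply_pair]
      rw [norm_mul, norm_mul, norm_mul, norm_gauss, Complex.norm_real, Complex.norm_real, Complex.norm_real,
        Real.norm_of_nonneg ht.le, Real.norm_of_nonneg (one_div_nonneg.2 (den_pos hu).le), Real.rpow_two, Real.norm_eq_abs]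
      have := sin_bd ht hu
      have hE := Real.exp_pos (-(π * s.re) * t^2)
      have hd := one_div_nonneg.2 (den_pos hu).le
      calc _ ≤ t * rexp (-(π * s.re) * t^2) * (2 * π * t * u) * (1 / (rexp (2 * π * u) - 1)) := by gcongr
        _ = _ := by rw [hh]; ring
  have hswap := integral_integral_swap hGint
  have hL : ∫ t in Set.Ioi (0:ℝ), ∫ u in Set.Ioi (0:ℝ), G t u
      = (1/2) * (FF s + 1 / (4 * π * s) - (1 / s) ^ (1/2 : ℂ) / (4 * π)) := by
    have i1 := FF_int hs.le
    have i2 := (integrable_mul_cexp_neg_mul_sq hb).integrableOn (s := Set.Ioi (0:ℝ))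
    have i3 := (integrable_cexp_neg_mul_sq hb).integrableOn (s := Set.Ioi (0:ℝ))
    have e2 := integral_mul_cexp_neg_mul_sq hb
    have e3 := integral_gaussian_complex_Ioi hb
    rw [show (π:ℂ) / (π * s) = 1 / s by field_simp] at e3
    have : ∫ t in Set.Ioi (0:ℝ), ∫ u in Set.Ioi (0:ℝ), G t u = ∫ t in Set.Ioi (0:ℝ),
        ((1/2) * (Complex.exp (-(π * s) * (t:ℂ)^2) * (hh t : ℂ)) + (1/4) * ((t:ℂ) * Complex.exp (-(π * s) * (t:ℂ)^2))
          - (1 / (4 * π)) * Complex.exp (-(π * s) * (t:ℂ)^2)) := by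
      refine setIntegral_congr_fun measurableSet_Ioi ?_
      intro t ht
      have ht : 0 < t := ht
      simp only [hG]
      have : ∫ u in Set.Ioi (0:ℝ), (t:ℂ) * Complex.exp (-(π * s) * (t:ℂ)^2) *
          (Real.sin (2 * π * t * u) : ℂ) * ((1 / (rexp (2 * π * u) - 1) : ℝ) : ℂ)
          = (t:ℂ) * Complex.exp (-(π * s) * (t:ℂ)^2) * ((∫ u in Set.Ioi (0:ℝ), Real.sin (2 * π * t * u) / (rexp (2 * π * u) - 1) : ℝ) : ℂ) := by
        rw [← integral_complex_ofReal, ← integral_const_mul]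
        congr 1; ext u; push_cast; ring
      rw [this, sin_transform ht, hh]
      have hd : ((rexp (2 * π * t) : ℝ) : ℂ) - 1 ≠ 0 := by exact_mod_cast (den_pos ht).ne'
      have ht' : (t:ℂ) ≠ 0 := by exact_mod_cast ht.ne'
      push_cast [-Complex.ofReal_exp]
      generalize ((rexp (2 * π * t) : ℝ) : ℂ) = E at *
      field_simp
      ring
    have i12 : IntegrableOn (fun t : ℝ => (1/2) * (Complex.exp (-(π * s) * (t:ℂ)^2) * (hh t : ℂ)) + (1/4) * ((t:ℂ) * Complex.exp (-(π * s) * (t:ℂ)^2))) (Set.Ioi 0) :=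
      (i1.const_mul _).add (i2.const_mul _)
    rw [this, integral_sub i12 (i3.const_mul _),
      integral_add (i1.const_mul _) (i2.const_mul _), integral_const_mul, integral_const_mul, integral_const_mul, e2, e3, FF]
    generalize (1 / s) ^ (1/2 : ℂ) = C
    field_simp
  have hR : ∫ u in Set.Ioi (0:ℝ), ∫ t in Set.Ioi (0:ℝ), G t u
      = (1/2) * ((1 / s) ^ (1/2 : ℂ) / s * FF (1 / s)) := by
    rw [FF, ← integral_const_mul, ← integral_const_mul]
    refine setIntegral_congr_fun measurableSet_Ioi ?_
    intro u hu
    simp only [hG]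
    rw [integral_mul_const, gauss_sin hs, hh, one_div s]
    push_cast
    ring
  rw [hL, hR] at hswap
  exact mul_left_cancel₀ (by norm_num) hswap

lemma FF_eq' {s : ℂ} (hs : 0 ≤ s.re) (hs0 : s ≠ 0) :
    FF s + 1 / (4 * π * s) - (1 / s) ^ (1/2 : ℂ) / (4 * π) = (1 / s) ^ (1/2 : ℂ) / s * FF (1 / s) := by
  have hpi : (π : ℂ) ≠ 0 := by exact_mod_cast Real.pi_ne_zero
  set T : Set ℂ := {s | 0 ≤ s.re ∧ s ≠ 0}
  have hre : ∀ z ∈ T, 0 ≤ (1 / z).re := by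
    intro z hz
    rw [one_div, Complex.inv_re]
    exact div_nonneg hz.1 (Complex.normSq_nonneg _)
  have hinv : ContinuousOn (fun z : ℂ => 1 / z) T :=
    continuousOn_const.div continuousOn_id (fun z hz => hz.2)
  have hc : ContinuousOn (fun z : ℂ => (1 / z) ^ (1/2 : ℂ)) T := by
    refine hinv.cpow_const ?_
    intro z hz
    rw [Complex.mem_slitPlane_iff]
    by_contra! h
    have h1 := hre z hz
    have h2 : 1 / z = 0 := Complex.ext (le_antisymm h.1 h1) h.2
    exact (one_div_ne_zero hz.2) h2
  have hF1 : ContinuousOn FF T := FF_cont.mono fun z hz => hz.1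
  have hF2 : ContinuousOn (fun z => FF (1 / z)) T := FF_cont.comp hinv hre
  have main : Set.EqOn (fun s => FF s + 1 / (4 * π * s) - (1 / s) ^ (1/2 : ℂ) / (4 * π))
      (fun s => (1 / s) ^ (1/2 : ℂ) / s * FF (1 / s)) T := by
    refine Set.EqOn.of_subset_closure (s := {s : ℂ | 0 < s.re}) (fun z hz => FF_eq hz) ?_ ?_ ?_ ?_
    · refine (hF1.add (continuousOn_const.div (by fun_prop) ?_)).sub (hc.div_const _)
      intro z hz
      simp [hpi, hz.2]
    · exact (hc.div continuousOn_id fun z hz => hz.2).mul hF2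
    · intro z hz
      refine ⟨le_of_lt hz, ?_⟩
      rintro rfl; simp at hz
    · intro z hz
      rw [Complex.closure_setOfPred_lt_re]
      exact hz.1
  exact main ⟨hs, hs0⟩

lemma subst (g : ℝ → ℝ) : ∫ x in Set.Ioi (0:ℝ), g x / (rexp (2 * π * Real.sqrt x) - 1)
    = 2 * ∫ t in Set.Ioi (0:ℝ), g (t^2) * hh t := by
  rw [← integral_comp_rpow_Ioi_of_pos (p := 2) (by norm_num), ← integral_const_mul]
  refine setIntegral_congr_fun measurableSet_Ioi ?_
  intro t ht
  have ht : 0 < t := ht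
  simp only [smul_eq_mul, Real.rpow_two, hh]
  rw [Real.sqrt_sq ht.le, show (2:ℝ) - 1 = 1 by norm_num, Real.rpow_one]
  ring

noncomputable def SS (a : ℝ) : ℝ := ∫ x in Set.Ioi (0:ℝ), Real.sin (π * a * x) / (Real.exp (2 * π * Real.sqrt x) - 1)

lemma FF_val (a : ℝ) : FF (-(Complex.I * a)) = (1/2) * ((Phi3 a : ℂ) + Complex.I * (SS a : ℂ)) := by
  have hi := FF_int (s := -(Complex.I * a)) (by simp)
  have e : ∀ t : ℝ, Complex.exp (-(π * (-(Complex.I * a))) * (t:ℂ)^2) = Complex.exp ((π * a * t^2 : ℝ) * Complex.I) := by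
    intro t; congr 1; push_cast; ring
  have h1 : (FF (-(Complex.I * a))).re = (1/2) * Phi3 a := by
    rw [Phi3, subst (fun x => Real.cos (π * a * x)), FF, ← Complex.reCLM_apply, ← Complex.reCLM.integral_comp_comm hi, ← mul_assoc]
    norm_num
    congr 1; ext t
    have := e t
    simp only [mul_neg, neg_neg] at this
    rw [this, Complex.exp_ofReal_mul_I_re]
  have h2 : (FF (-(Complex.I * a))).im = (1/2) * SS a := by
    rw [SS, subst (fun x => Real.sin (π * a * x)), FF, ← Complex.imCLM_apply, ← Complex.imCLM.integral_comp_comm hi, ← mul_assoc]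
    norm_num
    congr 1; ext t
    have := e t
    simp only [mul_neg, neg_neg] at this
    rw [this, Complex.exp_ofReal_mul_I_im]
  apply Complex.ext
  · rw [h1]; simp
  · rw [h2]; simp

theorem stmt6 (n : ℝ) (hn : 0 < n) :
    ∫ x in Set.Ioi (0:ℝ), Real.sin (π * n * x) / (Real.exp (2 * π * Real.sqrt x) - 1)
      = (1 / n) * Real.sqrt (2 / n) * Phi3 (1 / n) + Phi3 n - 1 / (2 * π * n) := by
  change SS n = _
  have hn' : (n:ℂ) ≠ 0 := by exact_mod_cast hn.ne'
  have hI := Complex.I_ne_zero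
  have hpi : (π : ℂ) ≠ 0 := by exact_mod_cast Real.pi_ne_zero
  have h := FF_eq' (s := -(Complex.I * n)) (by simp) (by simp [hn'])
  have conjFF : FF (1 / (-(Complex.I * n))) = (1/2) * ((Phi3 (1/n) : ℂ) - Complex.I * (SS (1/n) : ℂ)) := by
    have : (1 : ℂ) / (-(Complex.I * n)) = -(Complex.I * ((-(1/n) : ℝ) : ℂ)) := by
      push_cast; field_simp; simp
    rw [this, FF_val]
    have a1 : Phi3 (-(1/n)) = Phi3 (1/n) := by
      unfold Phi3; congr 1; ext x; rw [← Real.cos_neg]; ring_nf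
    have a2 : SS (-(1/n)) = -SS (1/n) := by
      unfold SS; rw [← integral_neg]; congr 1; ext x
      rw [show π * -(1/n) * x = -(π * (1/n) * x) by ring, Real.sin_neg, neg_div]
    rw [a1, a2]; push_cast; ring
  rw [conjFF, FF_val] at h
  set r : ℝ := Real.sqrt (2 / n) with hr
  have hr2 : r ^ 2 = 2 / n := Real.sq_sqrt (by positivity)
  have hr0 : 0 < r := Real.sqrt_pos.2 (by positivity)
  have hc : (1 / (-(Complex.I * n))) ^ (1/2 : ℂ) = (r / 2) * (1 + Complex.I) := by
    have hr2' : (r:ℂ)^2 = 2 / n := by exact_mod_cast hr2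
    have : (1 : ℂ) / (-(Complex.I * n)) = ((r / 2) * (1 + Complex.I)) ^ 2 := by
      have : ((r / 2) * (1 + Complex.I)) ^ 2 = (r:ℂ)^2 * Complex.I / 2 := by
        linear_combination ((r:ℂ)^2 / 4) * Complex.I_sq
      rw [this, hr2']; field_simp; simp
    rw [this, one_div, Complex.sq_cpow_two_inv]
    simp; exact hr0
  rw [hc] at h
  have hinv : (1:ℂ) / (4 * π * -(Complex.I * n)) = ((1 / (4 * π * n) : ℝ) : ℂ) * Complex.I := by
    push_cast; field_simp; simp
  have hinv2 : ((r:ℂ) / 2) * (1 + Complex.I) / -(Complex.I * n) = ((r / (2 * n) : ℝ) : ℂ) * (Complex.I - 1) := by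
    push_cast; field_simp
    linear_combination (-r:ℂ) * Complex.I_sq
  have hinv3 : ((r:ℂ) / 2) * (1 + Complex.I) / (4 * π) = ((r / (8 * π) : ℝ) : ℂ) * (1 + Complex.I) := by
    push_cast; field_simp; ring
  rw [hinv, hinv2, hinv3] at h
  have hB : r / (2 * n) = 1 / 2 * (1 / n * r) := by field_simp
  have hC : 1 / (4 * π * n) = 1 / 2 * (1 / (2 * π * n)) := by field_simp; norm_num
  rw [hB, hC] at h
  have hre := congrArg Complex.re h
  have him := congrArg Complex.im h
  clear hB hC hinv hinv2 hinv3 h conjFF hc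
  generalize r / (8 * π) = A at *
  generalize 1 / n * r = B at *
  generalize 1 / (2 * π * n) = C at *
  generalize Phi3 (1 / n) = P1 at *
  generalize SS (1 / n) = S1 at *
  simp only [Complex.add_re, Complex.sub_re, Complex.mul_re, Complex.add_im, Complex.sub_im, Complex.mul_im,
    Complex.ofReal_re, Complex.ofReal_im, Complex.I_re, Complex.I_im, Complex.one_re, Complex.one_im] at hre him
  norm_num at hre him
  linarith
end
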